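/- Let 𝓜 be a deterministic LBA with input of length n and let Π = (Ṽ, R) be the simulating Boolean P system with quasimode M̃ = {R}. Encode a configuration c = Z_l w₁…w_j₋₁ q w̄_j w_{j+1}…w_n Z_r of 𝓜 as the subset W(c) = { A_{w_j,j} | 0 ≤ j ≤ n+1 } ∪ { C_{q,j} } of Ṽ (with w₀ = Z_l, w_{n+1} = Z_r). Then 𝓜 moves from configuration c to configuration c' in one transition if and only if Π moves from W(c) to W(c') in one step under M̃. -/

import Mathlib

/-- A rule `A → B | φ` of a Boolean P system: a left-hand side `A ⊆ V`,
a right-hand side `B ⊆ V`, and a guard `φ`, a predicate on subsets of `V`. -/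
structure BRule (σ : Type*) where
  lhs : Set σ
  rhs : Set σ
  guard : Set σ → Prop

/-- A rule `A → B | φ` is applicable to a configuration `W` iff `A ⊆ W` and `φ(W)` holds. -/
def BRule.applicable {σ : Type*} (r : BRule σ) (W : Set σ) : Prop :=
  r.lhs ⊆ W ∧ r.guard W

/-- `Appl R W` : the set of all subsets of the rule set `R` each of whose
rules is applicable to `W`. -/
def Appl {σ : Type*} (R : Set (BRule σ)) (W : Set σ) : Set (Set (BRule σ)) :=
  {m | m ⊆ R ∧ ∀ r ∈ m, r.applicable W}

/-- Applying a set of (individually applicable) rules `{Aᵢ → Bᵢ | φᵢ}` to `W`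
yields `(W \ ⋃ᵢ Aᵢ) ∪ ⋃ᵢ Bᵢ`. -/
def applyRules {σ : Type*} (m : Set (BRule σ)) (W : Set σ) : Set σ :=
  (W \ ⋃ r ∈ m, BRule.lhs r) ∪ ⋃ r ∈ m, BRule.rhs r

/-- Applying a set of rules to `W`, where exactly those rules of the set that
are applicable to `W` are applied. -/
def applyAppl {σ : Type*} (m : Set (BRule σ)) (W : Set σ) : Set σ :=
  applyRules {r ∈ m | r.applicable W} W

/-- `A ⊗ B = { a ∪ b | a ∈ A, b ∈ B }` for sets of sets. -/
def otimes {α : Type*} (A B : Set (Set α)) : Set (Set α) :=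
  {c | ∃ a ∈ A, ∃ b ∈ B, c = a ∪ b}

/-- One evolution step of a Boolean P system under a quasimode `Mt`: choose a
set of rules `m ∈ Mt` and apply all of its rules applicable to the current
configuration. -/
def QStep {σ : Type*} (Mt : Set (Set (BRule σ))) (W W' : Set σ) : Prop :=
  ∃ m ∈ Mt, W' = applyAppl m W

/-- Head movement directions of an LBA. -/
inductive Dir | L | R | S
deriving DecidableEq

/-- Position update: `L` moves left, `R` moves right, `S` stays. -/
def movePos : Dir → ℕ → ℕ
  | Dir.L, j => j - 1
  | Dir.R, j => j + 1
  | Dir.S, j => j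

/-- A deterministic linear bounded automaton
`𝓜 = (Q, V, T₁, T₂, δ, q₀, q₁, Z_l, B, Z_r)`.  The transition function is
restricted so that the boundary markers are never overwritten or exceeded. -/
structure LBA (Q V : Type*) where
  T1 : Set V
  T2 : Set V
  δ : Q → V → Q × V × Dir
  q0 : Q
  q1 : Q
  Zl : V
  B : V
  Zr : V
  hT1 : Zl ∉ T1 ∧ B ∉ T1 ∧ Zr ∉ T1
  hT2 : Zl ∉ T2 ∧ B ∉ T2 ∧ Zr ∉ T2
  hZl : ∀ q, (δ q Zl).2.1 = Zl ∧ (δ q Zl).2.2 ≠ Dir.L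
  hZr : ∀ q, (δ q Zr).2.1 = Zr ∧ (δ q Zr).2.2 ≠ Dir.R

/-- A configuration of an LBA: the current state, the head position,
and the tape contents. -/
abbrev LBACfg (Q V : Type*) := Q × ℕ × (ℕ → V)

/-- The one-step transition function of an LBA on configurations. -/
def lbaStep {Q V : Type*} (A : LBA Q V) (c : LBACfg Q V) : LBACfg Q V :=
  ((A.δ c.1 (c.2.2 c.2.1)).1,
   movePos (A.δ c.1 (c.2.2 c.2.1)).2.2 c.2.1,
   Function.update c.2.2 c.2.1 (A.δ c.1 (c.2.2 c.2.1)).2.1)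

/-- The symbols of the simulating Boolean P system: `A_{v,j} = inl (v, j)`
encodes that cell `j` contains `v`, and `C_{q,j} = inr (q, j)` encodes that
the head is on cell `j` in state `q`. -/
abbrev LSym (Q V : Type*) := (V × ℕ) ⊕ (Q × ℕ)

/-- The rules `R = ⋃_{ρ∈δ} R_ρ` of the Boolean P system simulating an LBA on
inputs of length `n`: for each instruction `ρ = (q, X; p, Y, D)` and each cell
index `j` in the range determined by `D` (`0 ≤ j ≤ n` for `R`, `0 ≤ j ≤ n+1`
for `S`, `1 ≤ j ≤ n+1` for `L`), the rule
`{A_{X,j}, C_{q,j}} → {A_{Y,j}, C_{p, movePos D j}} | ⊤`. -/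
def lbaRules {Q V : Type*} (A : LBA Q V) (n : ℕ) : Set (BRule (LSym Q V)) :=
  {r | ∃ (q : Q) (X : V) (j : ℕ),
    (match (A.δ q X).2.2 with
     | Dir.R => j ≤ n
     | Dir.S => j ≤ n + 1
     | Dir.L => 1 ≤ j ∧ j ≤ n + 1) ∧
    r = ⟨{Sum.inl (X, j), Sum.inr (q, j)},
         {Sum.inl ((A.δ q X).2.1, j),
          Sum.inr ((A.δ q X).1, movePos (A.δ q X).2.2 j)},
         fun _ => True⟩}

/-- The encoding of an LBA configuration `c = (q, pos, w)` (with tape cells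
`0..n+1`) as the subset `W(c) = { A_{w_j,j} | 0 ≤ j ≤ n+1 } ∪ { C_{q,pos} }`. -/
def encodeCfg {Q V : Type*} (n : ℕ) (c : LBACfg Q V) : Set (LSym Q V) :=
  {s | ∃ j ≤ n + 1, s = Sum.inl (c.2.2 j, j)} ∪ {Sum.inr (c.1, c.2.1)}

/-- One transition of the LBA `𝓜` from `c` to `c'` (only the tape cells
`0 ≤ j ≤ n+1` are relevant): with `δ(q, w_pos) = (p, b, D)`, the new state is
`p`, the head moves according to `D`, and cell `pos` now contains `b`. -/
def lbaStepRel {Q V : Type*} (A : LBA Q V) (n : ℕ) (c c' : LBACfg Q V) : Prop :=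
  c'.1 = (A.δ c.1 (c.2.2 c.2.1)).1 ∧
  c'.2.1 = movePos (A.δ c.1 (c.2.2 c.2.1)).2.2 c.2.1 ∧
  ∀ j ≤ n + 1,
    c'.2.2 j = Function.update c.2.2 c.2.1 (A.δ c.1 (c.2.2 c.2.1)).2.1 j

theorem aux_rules {Q V : Type*} (A : LBA Q V) (n : ℕ) (c : LBACfg Q V)
    (hpos : c.2.1 ≤ n + 1) (h0 : c.2.2 0 = A.Zl) (hn1 : c.2.2 (n + 1) = A.Zr) :
    {r ∈ lbaRules A n | r.applicable (encodeCfg n c)} =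
      {⟨{Sum.inl (c.2.2 c.2.1, c.2.1), Sum.inr (c.1, c.2.1)},
         {Sum.inl ((A.δ c.1 (c.2.2 c.2.1)).2.1, c.2.1),
          Sum.inr ((A.δ c.1 (c.2.2 c.2.1)).1,
            movePos (A.δ c.1 (c.2.2 c.2.1)).2.2 c.2.1)},
         fun _ => True⟩} := by
  obtain ⟨q, p, w⟩ := c
  simp only at hpos h0 hn1 ⊢
  ext r
  simp only [Set.mem_setOf_eq, Set.mem_singleton_iff]
  constructor
  · rintro ⟨⟨q', X, j, hj, rfl⟩, h, -⟩
    have h1 := h (Set.mem_insert _ _)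
    have h2 := h (Set.mem_insert_of_mem _ rfl)
    simp [encodeCfg] at h1 h2
    obtain ⟨rfl, rfl⟩ := h2
    obtain ⟨_, rfl⟩ := h1
    rfl
  · rintro rfl
    refine ⟨⟨q, w p, p, ?_, rfl⟩, ?_, trivial⟩
    · have hl := A.hZl q
      have hr := A.hZr q
      rw [← h0] at hl
      rw [← hn1] at hr
      split
      · rename_i h
        by_contra hc
        obtain rfl : p = n + 1 := by omega
        exact hr.2 h
      · exact hpos
      · rename_i h
        refine ⟨?_, hpos⟩
        by_contra hc
        obtain rfl : p = 0 := by omega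
        exact hl.2 h
    · rintro s (rfl | rfl)
      · exact Or.inl ⟨p, hpos, rfl⟩
      · exact Or.inr rfl

theorem aux_apply {Q V : Type*} (A : LBA Q V) (n : ℕ) (c : LBACfg Q V)
    (hpos : c.2.1 ≤ n + 1) (h0 : c.2.2 0 = A.Zl) (hn1 : c.2.2 (n + 1) = A.Zr) :
    applyAppl (lbaRules A n) (encodeCfg n c) = encodeCfg n (lbaStep A c) := by
  rw [applyAppl, aux_rules A n c hpos h0 hn1]
  obtain ⟨q, p, w⟩ := c
  simp only at hpos h0 hn1
  ext s
  rcases s with ⟨v, j⟩ | ⟨q', j⟩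
  · simp only [applyRules, encodeCfg, lbaStep, Function.update_apply]
    simp
    grind
  · simp [applyRules, encodeCfg, lbaStep]

theorem aux_inj {Q V : Type*} (n : ℕ) (c c' : LBACfg Q V) :
    encodeCfg n c = encodeCfg n c' ↔
      c'.1 = c.1 ∧ c'.2.1 = c.2.1 ∧ ∀ j ≤ n + 1, c'.2.2 j = c.2.2 j := by
  constructor
  · intro h
    have h1 : Sum.inr (c.1, c.2.1) ∈ encodeCfg n c' := h ▸ Or.inr rfl
    simp [encodeCfg] at h1
    refine ⟨h1.1.symm, h1.2.symm, fun j hj => ?_⟩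
    have h2 : Sum.inl (c.2.2 j, j) ∈ encodeCfg n c' := h ▸ Or.inl ⟨j, hj, rfl⟩
    simp [encodeCfg] at h2
    exact h2.2.symm
  · rintro ⟨h1, h2, h3⟩
    ext s
    rcases s with ⟨v, j⟩ | ⟨q', j⟩
    · simp [encodeCfg]
      grind
    · simp [encodeCfg, h1, h2]

/-- for configurations `c`, `c'` of the LBA (head within the tape,
boundary markers in cells `0` and `n+1`), `𝓜` moves from `c` to `c'` in one
transition iff the simulating Boolean P system `Π` moves from `W(c)` to `W(c')`
in one step under the quasimode `M̃ = {R}` (which applies all applicable rules). -/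
theorem stmt10 {Q V : Type*} [Finite Q] [Finite V]
    (A : LBA Q V) (n : ℕ) (c c' : LBACfg Q V)
    (hpos : c.2.1 ≤ n + 1) (h0 : c.2.2 0 = A.Zl) (hn1 : c.2.2 (n + 1) = A.Zr)
    (hpos' : c'.2.1 ≤ n + 1) (h0' : c'.2.2 0 = A.Zl) (hn1' : c'.2.2 (n + 1) = A.Zr) :
    lbaStepRel A n c c' ↔
      applyAppl (lbaRules A n) (encodeCfg n c) = encodeCfg n c' := by
  rw [aux_apply A n c hpos h0 hn1, aux_inj]
  rfl
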